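/- Let (V, 𝒱) be a measurable space, μ a probability measure on V, and κ₁, κ₂ Markov kernels from V to ℝ. Then the Kullback–Leibler divergence of the mixture distributions satisfies D(μ.bind κ₁ ‖ μ.bind κ₂) ≤ ∫ D(κ₁(v) ‖ κ₂(v)) dμ(v). -/

import Mathlib

open MeasureTheory ProbabilityTheory Real Classical
open scoped ENNReal

/-- Kullback–Leibler divergence of probability measures: `∫ log (dP/dQ) dP` when `P ≪ Q`
(and the integrand is integrable, in which case this integral is nonnegative), and `+∞`
otherwise. -/
noncomputable def klDiv (P Q : Measure ℝ) : ℝ≥0∞ :=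
  if P ≪ Q ∧ Integrable (fun x => Real.log (P.rnDeriv Q x).toReal) P then
    ENNReal.ofReal (∫ x, Real.log (P.rnDeriv Q x).toReal ∂P)
  else ⊤

lemma klDiv_eq_infoKL (P Q : Measure ℝ) [IsProbabilityMeasure P] [IsProbabilityMeasure Q] :
    klDiv P Q = InformationTheory.klDiv P Q := by
  rw [klDiv, InformationTheory.klDiv_def]
  simp only [probReal_univ, add_sub_cancel_right]
  rfl

lemma compProd_eq_withDensity_rnDeriv {V : Type*} [MeasurableSpace V]
    (μ : Measure V) [IsProbabilityMeasure μ]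
    (κ₁ κ₂ : Kernel V ℝ) [IsMarkovKernel κ₁] [IsMarkovKernel κ₂]
    (h : ∀ᵐ v ∂μ, κ₁ v ≪ κ₂ v) :
    μ.compProd κ₁ = (μ.compProd κ₂).withDensity (fun p => Kernel.rnDeriv κ₁ κ₂ p.1 p.2) := by
  ext s hs
  rw [withDensity_apply _ hs, Measure.compProd_apply hs, ← lintegral_indicator hs,
    Measure.lintegral_compProd ((Kernel.measurable_rnDeriv κ₁ κ₂).indicator hs)]
  refine lintegral_congr_ae ?_
  filter_upwards [h] with v hv
  rw [← Kernel.setLIntegral_rnDeriv hv (measurable_prodMk_left hs),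
    ← lintegral_indicator (measurable_prodMk_left hs)]
  rfl

lemma infoKL_compProd_le {V : Type*} [MeasurableSpace V]
    (μ : Measure V) [IsProbabilityMeasure μ]
    (κ₁ κ₂ : Kernel V ℝ) [IsMarkovKernel κ₁] [IsMarkovKernel κ₂] :
    InformationTheory.klDiv (μ.compProd κ₁) (μ.compProd κ₂)
      ≤ ∫⁻ v, InformationTheory.klDiv (κ₁ v) (κ₂ v) ∂μ := by
  by_cases h : ∀ᵐ v ∂μ, κ₁ v ≪ κ₂ v
  · have hac := Measure.absolutelyContinuous_compProd_right_iff.2 h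
    rw [InformationTheory.klDiv_eq_lintegral_klFun_of_ac hac]
    have hm := Kernel.measurable_rnDeriv κ₁ κ₂
    have hr : (μ.compProd κ₁).rnDeriv (μ.compProd κ₂) =ᵐ[μ.compProd κ₂]
        fun p => Kernel.rnDeriv κ₁ κ₂ p.1 p.2 := by
      rw [compProd_eq_withDensity_rnDeriv μ κ₁ κ₂ h]
      exact Measure.rnDeriv_withDensity _ hm
    have h1 : ∫⁻ p, ENNReal.ofReal (InformationTheory.klFun
          ((μ.compProd κ₁).rnDeriv (μ.compProd κ₂) p).toReal) ∂(μ.compProd κ₂)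
        = ∫⁻ p, ENNReal.ofReal (InformationTheory.klFun
          (Kernel.rnDeriv κ₁ κ₂ p.1 p.2).toReal) ∂(μ.compProd κ₂) := by
      refine lintegral_congr_ae ?_
      filter_upwards [hr] with p hp
      rw [hp]
    rw [h1, Measure.lintegral_compProd (by fun_prop)]
    refine le_of_eq (lintegral_congr_ae ?_)
    filter_upwards [h] with v hv
    rw [InformationTheory.klDiv_eq_lintegral_klFun_of_ac hv]
    refine lintegral_congr_ae ?_
    filter_upwards [Kernel.rnDeriv_eq_rnDeriv_measure (κ := κ₁) (η := κ₂) (a := v)] with x hx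
    rw [hx]
  · have hs := Kernel.measurableSet_absolutelyContinuous κ₁ κ₂
    have hpos : μ {v | κ₁ v ≪ κ₂ v}ᶜ ≠ 0 := h
    have : ∫⁻ v, InformationTheory.klDiv (κ₁ v) (κ₂ v) ∂μ = ⊤ := by
      rw [eq_top_iff]
      calc (⊤ : ℝ≥0∞) = ∫⁻ v, ({v | κ₁ v ≪ κ₂ v}ᶜ).indicator (fun _ => ⊤) v ∂μ := by
            rw [lintegral_indicator hs.compl, setLIntegral_const, ENNReal.top_mul hpos]
        _ ≤ _ := by
            refine lintegral_mono fun v => ?_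
            by_cases hv : κ₁ v ≪ κ₂ v
            · simp [hv]
            · simp [hv, InformationTheory.klDiv_of_not_ac hv]
    rw [this]
    exact le_top

theorem klDiv_bind_le_integral {V : Type*} [MeasurableSpace V]
    (μ : Measure V) [IsProbabilityMeasure μ]
    (κ₁ κ₂ : Kernel V ℝ) [IsMarkovKernel κ₁] [IsMarkovKernel κ₂] :
    klDiv (μ.bind κ₁) (μ.bind κ₂) ≤ ∫⁻ v, klDiv (κ₁ v) (κ₂ v) ∂μ := by
  simp_rw [klDiv_eq_infoKL]
  refine le_trans ?_ (infoKL_compProd_le μ κ₁ κ₂)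
  rw [← Measure.snd_compProd, ← Measure.snd_compProd]
  exact InformationTheory.klDiv_map_le _ _ measurable_snd
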